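/- arXiv:1211.4677 — 4 statements merged into one kernel-verified Lean document; each statement's English description precedes it below -/
import Mathlib

section
/- Suppose $p \in Q_{Ad}$ satisfies $p(P) = 0$ and $\nabla p(P) = (0,0)$ at each of the four vertices $P \in \{(\pm 1, \pm 1)\}$ of the reference square $\hat K = [-1,1]^2$. Then $p$ is the zero polynomial. (In particular, the Adini vertex-interpolation problem on $\hat K$ is unisolvent: any function can have at most one interpolant in $Q_{Ad}$ matching its values and gradients at the four vertices.) -/
open MvPolynomial

/-- The Adini shape space `Q_Ad = P₃ + span{x³y, xy³}` as a set of real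
polynomials in two variables (`X 0` is `x`, `X 1` is `y`). -/
def QAd : Set (MvPolynomial (Fin 2) ℝ) :=
  {p | ∃ q : MvPolynomial (Fin 2) ℝ, ∃ c₁ c₂ : ℝ, q.totalDegree ≤ 3 ∧
    p = q + C c₁ * (X 0 ^ 3 * X 1) + C c₂ * (X 0 * X 1 ^ 3)}

/-- A bivariate polynomial of total degree at most `n` is the sum of its monomials
`xⁱyʲ` with `i + j ≤ n`. -/
theorem MvPolynomial.eq_sum_range_of_totalDegree_le {R : Type*} [CommSemiring R]
    (q : MvPolynomial (Fin 2) R) {n : ℕ} (hq : q.totalDegree ≤ n) :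
    q = ∑ i ∈ Finset.range (n + 1), ∑ j ∈ Finset.range (n + 1 - i),
      C (q.coeff (Finsupp.single 0 i + Finsupp.single 1 j)) * (X 0 ^ i * X 1 ^ j) := by
  classical
  have hmon (i j : ℕ) (a : R) : C a * (X 0 ^ i * X 1 ^ j) =
      monomial (Finsupp.single (0 : Fin 2) i + Finsupp.single 1 j) a := by
    rw [X_pow_eq_monomial, X_pow_eq_monomial, monomial_mul, C_mul_monomial, mul_one, mul_one]
  have hexp (m : Fin 2 →₀ ℕ) (i j : ℕ) :
      Finsupp.single 0 i + Finsupp.single 1 j = m ↔ i = m 0 ∧ j = m 1 := by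
    simp [Finsupp.ext_iff, Fin.forall_fin_two]
  ext m
  simp only [hmon, coeff_sum, coeff_monomial, hexp]
  by_cases hm : m 0 + m 1 ≤ n
  · rw [Finset.sum_eq_single (m 0), Finset.sum_eq_single (m 1)]
    · simp [(hexp m _ _).2 ⟨rfl, rfl⟩]
    · intro j _ hj
      simp [hj]
    · intro h
      simp only [Finset.mem_range] at h
      omega
    · intro i _ hi
      simp [hi]
    · intro h
      simp only [Finset.mem_range] at h
      omega
  · rw [coeff_eq_zero_of_totalDegree_lt, Finset.sum_eq_zero]
    · intro i hi
      refine Finset.sum_eq_zero fun j hj => if_neg ?_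
      simp only [Finset.mem_range] at hi hj
      omega
    · have hdeg : ∑ i ∈ m.support, m i = m 0 + m 1 := by
        simpa [Finsupp.sum, Fin.sum_univ_two] using
          Finsupp.sum_fintype m (fun _ k => k) (fun _ => rfl)
      omega

/-- Unisolvence of the Adini vertex interpolation on the reference square:
if `p ∈ Q_Ad` vanishes together with its gradient at the four vertices
`(±1, ±1)`, then `p = 0`. -/
theorem adini_unisolvent (p : MvPolynomial (Fin 2) ℝ) (hp : p ∈ QAd)
    (hval : ∀ s ∈ ({-1, 1} : Set ℝ), ∀ t ∈ ({-1, 1} : Set ℝ),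
      eval ![s, t] p = 0)
    (hgrad : ∀ s ∈ ({-1, 1} : Set ℝ), ∀ t ∈ ({-1, 1} : Set ℝ),
      eval ![s, t] (pderiv 0 p) = 0 ∧ eval ![s, t] (pderiv 1 p) = 0) :
    p = 0 := by
  obtain ⟨q, c₁, c₂, hq, rfl⟩ := hp
  have hsum := q.eq_sum_range_of_totalDegree_le hq
  simp only [Finset.sum_range_succ, Finset.sum_range_zero, Nat.reduceAdd, Nat.reduceSub,
    zero_add] at hsum
  generalize q.coeff (Finsupp.single 0 0 + Finsupp.single 1 0) = a₀₀ at hsum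
  generalize q.coeff (Finsupp.single 0 0 + Finsupp.single 1 1) = a₀₁ at hsum
  generalize q.coeff (Finsupp.single 0 0 + Finsupp.single 1 2) = a₀₂ at hsum
  generalize q.coeff (Finsupp.single 0 0 + Finsupp.single 1 3) = a₀₃ at hsum
  generalize q.coeff (Finsupp.single 0 1 + Finsupp.single 1 0) = a₁₀ at hsum
  generalize q.coeff (Finsupp.single 0 1 + Finsupp.single 1 1) = a₁₁ at hsum
  generalize q.coeff (Finsupp.single 0 1 + Finsupp.single 1 2) = a₁₂ at hsum
  generalize q.coeff (Finsupp.single 0 2 + Finsupp.single 1 0) = a₂₀ at hsum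
  generalize q.coeff (Finsupp.single 0 2 + Finsupp.single 1 1) = a₂₁ at hsum
  generalize q.coeff (Finsupp.single 0 3 + Finsupp.single 1 0) = a₃₀ at hsum
  subst hsum
  simp only [Set.mem_insert_iff, Set.mem_singleton_iff, forall_eq_or_imp, forall_eq] at hval hgrad
  simp [pderiv_X] at hval hgrad
  obtain ⟨⟨v₁, v₂⟩, v₃, v₄⟩ := hval
  obtain ⟨⟨⟨x₁, y₁⟩, x₂, y₂⟩, ⟨x₃, y₃⟩, x₄, y₄⟩ := hgrad
  ring_nf at v₁ v₂ v₃ v₄ x₁ x₂ x₃ x₄ y₁ y₂ y₃ y₄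
  obtain rfl : a₀₀ = 0 := by linarith
  obtain rfl : a₀₁ = 0 := by linarith
  obtain rfl : a₀₂ = 0 := by linarith
  obtain rfl : a₀₃ = 0 := by linarith
  obtain rfl : a₁₀ = 0 := by linarith
  obtain rfl : a₁₁ = 0 := by linarith
  obtain rfl : a₁₂ = 0 := by linarith
  obtain rfl : a₂₀ = 0 := by linarith
  obtain rfl : a₂₁ = 0 := by linarith
  obtain rfl : a₃₀ = 0 := by linarith
  obtain rfl : c₁ = 0 := by linarith
  obtain rfl : c₂ = 0 := by linarith
  simp
end

section
/- Let $u \in P_4$ and let $p \in Q_{Ad}$ be an Adini interpolant of $u$ on the reference square $\hat K = [-1,1]^2$ (i.e., $p$ and $\nabla p$ agree with $u$ and $\nabla u$ at the four vertices $(\pm 1,\pm 1)$). Then, denoting by $u_{xxxx}$, $u_{yyyy}$, $u_{xxyy}$ the (constant) fourth-order partial derivatives $\partial^4 u/\partial x^4$, $\partial^4 u/\partial y^4$, $\partial^4 u/\partial x^2 \partial y^2$ of $u$, one has the identity of polynomials $u - p = \frac{u_{xxxx}}{24}(x^2-1)^2 + \frac{u_{yyyy}}{24}(y^2-1)^2 +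 \frac{u_{xxyy}}{4}(x^2-1)(y^2-1)$. -/
open MvPolynomial

/-- A bivariate polynomial of total degree at most `n` is a combination of the monomials
`x ^ i * y ^ j` with `i + j ≤ n`. -/
theorem MvPolynomial.exists_eq_sum_of_totalDegree_le {R : Type*} [CommSemiring R] {n : ℕ}
    {p : MvPolynomial (Fin 2) R} (hp : p.totalDegree ≤ n) :
    ∃ a : ℕ → ℕ → R, p = ∑ i ∈ Finset.range (n + 1), ∑ j ∈ Finset.range (n + 1 - i),
      C (a i j) * X 0 ^ i * X 1 ^ j := by
  classical
  let m : ℕ → ℕ → (Fin 2 →₀ ℕ) := fun i j => Finsupp.single 0 i + Finsupp.single 1 j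
  have hm : ∀ v : Fin 2 →₀ ℕ, m (v 0) (v 1) = v := fun v => by
    ext k
    fin_cases k <;> simp [m]
  have hmon : ∀ i j (c : R), C c * X 0 ^ i * X 1 ^ j = monomial (m i j) c := fun i j c => by
    simp [m, X_pow_eq_monomial, C_mul_monomial, monomial_mul]
  refine ⟨fun i j => coeff (m i j) p, ?_⟩
  simp only [hmon]
  rw [Finset.sum_sigma']
  conv_lhs => rw [p.as_sum]
  refine Finset.sum_of_injOn (fun v => ⟨v 0, v 1⟩) ?_ ?_ ?_ ?_
  · intro v _ w _ h
    have h0 : v 0 = w 0 := congrArg Sigma.fst h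
    have h1 : v 1 = w 1 := congrArg (fun z : (_ : ℕ) × ℕ => z.2) h
    rw [← hm v, ← hm w, h0, h1]
  · intro v hv
    have h := (le_totalDegree hv).trans hp
    rw [Finsupp.sum_fintype _ _ (fun _ => rfl), Fin.sum_univ_two] at h
    simp only [Finset.coe_sigma, Set.mem_sigma_iff, Finset.coe_range, Set.mem_Iio]
    omega
  · rintro ⟨i, j⟩ _ h
    have hc : coeff (m i j) p = 0 := by
      by_contra hne
      exact h ⟨m i j, mem_support_iff.mpr hne, by simp [m]⟩
    simp [hc]
  · intro v _
    simp [hm]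

theorem MvPolynomial.pderiv_zero_C_mul_X_pow_mul_X_pow {R : Type*} [CommSemiring R] (c : R)
    (i j : ℕ) : pderiv (0 : Fin 2) (C c * X 0 ^ i * X 1 ^ j) =
      C (c * i) * X 0 ^ (i - 1) * X 1 ^ j := by
  simp [Derivation.leibniz, Derivation.leibniz_pow]
  ring

theorem MvPolynomial.pderiv_one_C_mul_X_pow_mul_X_pow {R : Type*} [CommSemiring R] (c : R)
    (i j : ℕ) : pderiv (1 : Fin 2) (C c * X 0 ^ i * X 1 ^ j) =
      C (c * j) * X 0 ^ i * X 1 ^ (j - 1) := by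
  simp [Derivation.leibniz, Derivation.leibniz_pow]
  ring

set_option maxHeartbeats 800000 in
/-- If `u ∈ P₄` and `p ∈ Q_Ad` is an Adini interpolant of `u` on the reference
square `[-1,1]²`, then
`u - p = (u_xxxx/24)(x²-1)² + (u_yyyy/24)(y²-1)² + (u_xxyy/4)(x²-1)(y²-1)`,
where the (constant polynomial) fourth derivatives of `u` appear as factors. -/
theorem adini_interpolation_error_expansion (u p : MvPolynomial (Fin 2) ℝ)
    (hu : u.totalDegree ≤ 4) (hp : p ∈ QAd)
    (hval : ∀ s ∈ ({-1, 1} : Set ℝ), ∀ t ∈ ({-1, 1} : Set ℝ),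
      eval ![s, t] p = eval ![s, t] u)
    (hgrad : ∀ s ∈ ({-1, 1} : Set ℝ), ∀ t ∈ ({-1, 1} : Set ℝ),
      eval ![s, t] (pderiv 0 p) = eval ![s, t] (pderiv 0 u) ∧
      eval ![s, t] (pderiv 1 p) = eval ![s, t] (pderiv 1 u)) :
    u - p =
      C (24 : ℝ)⁻¹ * (pderiv 0 (pderiv 0 (pderiv 0 (pderiv 0 u)))) *
          (X 0 ^ 2 - 1) ^ 2 +
      C (24 : ℝ)⁻¹ * (pderiv 1 (pderiv 1 (pderiv 1 (pderiv 1 u)))) *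
          (X 1 ^ 2 - 1) ^ 2 +
      C (4 : ℝ)⁻¹ * (pderiv 0 (pderiv 0 (pderiv 1 (pderiv 1 u)))) *
          ((X 0 ^ 2 - 1) * (X 1 ^ 2 - 1)) := by
  obtain ⟨a, rfl⟩ := exists_eq_sum_of_totalDegree_le hu
  obtain ⟨q, c₁, c₂, hq, rfl⟩ := hp
  obtain ⟨b, rfl⟩ := exists_eq_sum_of_totalDegree_le hq
  simp only [Set.mem_insert_iff, Set.mem_singleton_iff, forall_eq_or_imp, forall_eq] at hval hgrad
  simp [Finset.sum_range_succ, Derivation.leibniz_pow] at hval hgrad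
  obtain ⟨⟨v₁, v₂⟩, v₃, v₄⟩ := hval
  obtain ⟨⟨⟨x₁, y₁⟩, x₂, y₂⟩, ⟨x₃, y₃⟩, x₄, y₄⟩ := hgrad
  have h00 : b 0 0 = a 0 0 - a 4 0 - a 0 4 - a 2 2 := by linarith
  have h20 : b 2 0 = a 2 0 + 2 * a 4 0 + a 2 2 := by linarith
  have h02 : b 0 2 = a 0 2 + 2 * a 0 4 + a 2 2 := by linarith
  have h10 : b 1 0 = a 1 0 := by linarith
  have h01 : b 0 1 = a 0 1 := by linarith
  have h11 : b 1 1 = a 1 1 := by linarith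
  have h30 : b 3 0 = a 3 0 := by linarith
  have h21 : b 2 1 = a 2 1 := by linarith
  have h12 : b 1 2 = a 1 2 := by linarith
  have h03 : b 0 3 = a 0 3 := by linarith
  have h31 : c₁ = a 3 1 := by linarith
  have h13 : c₂ = a 1 3 := by linarith
  apply MvPolynomial.funext
  intro z
  simp only [map_sum, pderiv_zero_C_mul_X_pow_mul_X_pow, pderiv_one_C_mul_X_pow_mul_X_pow]
  simp [Finset.sum_range_succ, h00, h20, h02, h10, h01, h11, h30, h21, h12, h03, h31, h13]
  ring
end

section
/- Let $K = [x_c - h_x, x_c + h_x] \times [y_c - h_y, y_c + h_y]$ with $h_x, h_y > 0$, let $u \in P_4$, let $p \in Q_{Ad}$ be an Adini interpolant of $u$ on $K$, and let $v \in Q_{Ad}$. Then the mixed second derivatives are $L^2(K)$-orthogonal: $\int_K \frac{\partial^2 (u - p)}{\partial x \partial y} \, \frac{\partial^2 v}{\partial x \partial y} \, dx\,dy = 0$. -/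
open MvPolynomial MeasureTheory

namespace MvPolynomial

theorem exists_eq_sum_of_totalDegree_lt {R : Type*} [CommSemiring R] {n : ℕ}
    {p : MvPolynomial (Fin 2) R} (hp : p.totalDegree < n) :
    ∃ a : ℕ → ℕ → R,
      p = ∑ i ∈ Finset.range n, ∑ j ∈ Finset.range (n - i), C (a i j) * (X 0 ^ i * X 1 ^ j) := by
  refine ⟨fun i j => coeff (Finsupp.single 0 i + Finsupp.single 1 j) p, ?_⟩
  ext d
  have hd : Finsupp.single 0 (d 0) + Finsupp.single 1 (d 1) = d := by
    ext k; fin_cases k <;> simp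
  have hmon (i j : ℕ) (r : R) : coeff d (C r * (X 0 ^ i * X 1 ^ j)) =
      if i = d 0 then (if j = d 1 then r else 0) else 0 := by
    have hiff : Finsupp.single 0 i + Finsupp.single 1 j = d ↔ i = d 0 ∧ j = d 1 := by
      constructor
      · rintro rfl; simp
      · rintro ⟨rfl, rfl⟩; exact hd
    rw [X_pow_eq_monomial, X_pow_eq_monomial, monomial_mul, C_mul_monomial, coeff_monomial,
      ← ite_and]
    simp [hiff]
  simp only [coeff_sum, hmon]
  rw [Finset.sum_comm' (t' := Finset.range n) (s' := fun j => Finset.range (n - j))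
    (by intro i j; simp only [Finset.mem_range]; omega)]
  simp only [Finset.sum_ite_eq', Finset.mem_range]
  by_cases h : d 0 + d 1 < n
  · rw [Finset.sum_eq_single (d 1)]
    · rw [if_pos (by omega), if_pos rfl, hd]
    · intro j _ hj; simp [hj]
    · simp only [Finset.mem_range]; omega
  · rw [Finset.sum_eq_zero]
    · apply coeff_eq_zero_of_totalDegree_lt
      have : ∑ i ∈ d.support, d i = d 0 + d 1 := by
        rw [← Finsupp.degree_apply, Finsupp.degree_eq_sum, Fin.sum_univ_two]
      omega
    · intro j hj
      simp only [Finset.mem_range] at hj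
      split_ifs <;> first | rfl | omega

theorem exists_eq_sum_centered_of_totalDegree_lt {R : Type*} [CommRing R] {n : ℕ}
    {p : MvPolynomial (Fin 2) R} (hp : p.totalDegree < n) (x y : R) :
    ∃ a : ℕ → ℕ → R,
      p = ∑ i ∈ Finset.range n, ∑ j ∈ Finset.range (n - i),
        C (a i j) * ((X 0 - C x) ^ i * (X 1 - C y) ^ j) := by
  have hdeg : (aeval (![X 0 + C x, X 1 + C y] : Fin 2 → MvPolynomial (Fin 2) R) p).totalDegree ≤
      p.totalDegree := by
    rw [aeval_def, eval₂_eq]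
    refine totalDegree_finsetSum_le fun d hd => ?_
    have hfac (k : Fin 2) :
        ((![X 0 + C x, X 1 + C y] : Fin 2 → MvPolynomial (Fin 2) R) k).totalDegree ≤ 1 := by
      fin_cases k
      all_goals
        refine (totalDegree_add _ _).trans (max_le ?_ (by simp))
        exact (totalDegree_monomial_le _ _).trans (by simp)
    refine (totalDegree_mul _ _).trans ?_
    rw [algebraMap_eq, totalDegree_C, zero_add]
    refine (totalDegree_finsetProd _ _).trans (le_trans ?_ (le_totalDegree hd))
    refine Finset.sum_le_sum fun k _ => (totalDegree_pow _ _).trans ?_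
    simpa using Nat.mul_le_mul_left (d k) (hfac k)
  obtain ⟨a, ha⟩ := exists_eq_sum_of_totalDegree_lt (hdeg.trans_lt hp)
  refine ⟨a, ?_⟩
  have hinv : aeval ![X 0 - C x, X 1 - C y]
      (aeval (![X 0 + C x, X 1 + C y] : Fin 2 → MvPolynomial (Fin 2) R) p) = p := by
    rw [← AlgHom.comp_apply]
    conv_rhs => rw [← AlgHom.id_apply (R := R) p]
    congr 1
    ext k
    fin_cases k <;> simp [← algebraMap_eq]
  rw [← hinv, ha]
  simp [map_sum, ← algebraMap_eq]

theorem pderiv_ofNat {σ R : Type*} [CommSemiring R] (i : σ) (n : ℕ) [n.AtLeastTwo] :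
    pderiv i (ofNat(n) : MvPolynomial σ R) = 0 := by
  rw [← Nat.cast_ofNat (R := MvPolynomial σ R)]
  exact Derivation.map_natCast _ _

end MvPolynomial

theorem totalDegree_le_four_of_mem_QAd {p : MvPolynomial (Fin 2) ℝ} (hp : p ∈ QAd) :
    p.totalDegree ≤ 4 := by
  obtain ⟨q, c₁, c₂, hq, rfl⟩ := hp
  have hX (k : Fin 2) : (X k : MvPolynomial (Fin 2) ℝ).totalDegree = 1 := totalDegree_X k
  have h3 (k : Fin 2) : (X k ^ 3 : MvPolynomial (Fin 2) ℝ).totalDegree ≤ 3 :=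
    (totalDegree_pow _ _).trans (by simp [hX])
  refine (totalDegree_add _ _).trans (max_le ((totalDegree_add _ _).trans (max_le ?_ ?_)) ?_)
  · omega
  · refine (totalDegree_mul _ _).trans ?_
    have := totalDegree_mul (X 0 ^ 3 : MvPolynomial (Fin 2) ℝ) (X 1)
    have := h3 0
    have := hX 1
    rw [totalDegree_C]
    omega
  · refine (totalDegree_mul _ _).trans ?_
    have := totalDegree_mul (X 0 : MvPolynomial (Fin 2) ℝ) (X 1 ^ 3)
    have := h3 1
    have := hX 0
    rw [totalDegree_C]
    omega

/-- The mixed second derivative of an Adini function has no `(x - x_c) (y - y_c)` term. -/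
theorem exists_eval_pderiv_pderiv_of_mem_QAd {v : MvPolynomial (Fin 2) ℝ} (hv : v ∈ QAd)
    (xc yc : ℝ) :
    ∃ a b c d e : ℝ, ∀ x y : ℝ, eval ![x, y] (pderiv 0 (pderiv 1 v)) =
      a + b * (x - xc) + c * (y - yc) + d * (x - xc) ^ 2 + e * (y - yc) ^ 2 := by
  obtain ⟨q, c₁, c₂, hq, rfl⟩ := hv
  obtain ⟨a, rfl⟩ := exists_eq_sum_centered_of_totalDegree_lt (Nat.lt_succ_of_le hq) xc yc
  refine ⟨a 1 1 + 3 * c₁ * xc ^ 2 + 3 * c₂ * yc ^ 2, 2 * a 2 1 + 6 * c₁ * xc,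
    2 * a 1 2 + 6 * c₂ * yc, 3 * c₁, 3 * c₂, fun x y => ?_⟩
  simp [Finset.sum_range_succ, pderiv_X, pderiv_ofNat]
  ring

/-- A quartic whose values and gradients vanish at the vertices of a rectangle has a mixed second
derivative proportional to `(x - x_c) (y - y_c)`. -/
theorem exists_eval_pderiv_pderiv_of_vanish_vertices {xc yc hx hy : ℝ} (hhx : 0 < hx)
    (hhy : 0 < hy) {w : MvPolynomial (Fin 2) ℝ} (hw : w.totalDegree ≤ 4)
    (hval : ∀ s ∈ ({-1, 1} : Set ℝ), ∀ t ∈ ({-1, 1} : Set ℝ),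
      eval ![xc + s * hx, yc + t * hy] w = 0)
    (hgrad : ∀ s ∈ ({-1, 1} : Set ℝ), ∀ t ∈ ({-1, 1} : Set ℝ),
      eval ![xc + s * hx, yc + t * hy] (pderiv 0 w) = 0 ∧
      eval ![xc + s * hx, yc + t * hy] (pderiv 1 w) = 0) :
    ∃ c : ℝ, ∀ x y : ℝ,
      eval ![x, y] (pderiv 0 (pderiv 1 w)) = c * ((x - xc) * (y - yc)) := by
  obtain ⟨a, rfl⟩ := exists_eq_sum_centered_of_totalDegree_lt (Nat.lt_succ_of_le hw) xc yc
  have hsgn : (-1 : ℝ) ∈ ({-1, 1} : Set ℝ) ∧ (1 : ℝ) ∈ ({-1, 1} : Set ℝ) := by simp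
  have v1 := hval _ hsgn.1 _ hsgn.1
  have v2 := hval _ hsgn.1 _ hsgn.2
  have v3 := hval _ hsgn.2 _ hsgn.1
  have v4 := hval _ hsgn.2 _ hsgn.2
  have x1 := (hgrad _ hsgn.1 _ hsgn.1).1
  have x2 := (hgrad _ hsgn.1 _ hsgn.2).1
  have x3 := (hgrad _ hsgn.2 _ hsgn.1).1
  have x4 := (hgrad _ hsgn.2 _ hsgn.2).1
  have y1 := (hgrad _ hsgn.1 _ hsgn.1).2
  have y2 := (hgrad _ hsgn.1 _ hsgn.2).2
  have y3 := (hgrad _ hsgn.2 _ hsgn.1).2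
  have y4 := (hgrad _ hsgn.2 _ hsgn.2).2
  simp [Finset.sum_range_succ, pderiv_X] at v1 v2 v3 v4 x1 x2 x3 x4 y1 y2 y3 y4
  have h11 : a 1 1 = 0 := by
    refine (mul_eq_zero.1 (?_ : a 1 1 * (hx * hy) = 0)).resolve_right (by positivity)
    linear_combination (v1 - v2 - v3 + v4) / 2 - hx * (-x1 + x2 - x3 + x4) / 8
      - hy * (-y1 - y2 + y3 + y4) / 8
  have h21 : a 2 1 = 0 := by
    refine (mul_eq_zero.1 (?_ : a 2 1 * (hx ^ 2 * hy) = 0)).resolve_right (by positivity)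
    linear_combination hx * (x1 - x2 - x3 + x4) / 8
  have h12 : a 1 2 = 0 := by
    refine (mul_eq_zero.1 (?_ : a 1 2 * (hx * hy ^ 2) = 0)).resolve_right (by positivity)
    linear_combination hy * (y1 - y2 - y3 + y4) / 8
  have h31 : a 3 1 = 0 := by
    refine (mul_eq_zero.1 (?_ : a 3 1 * (hx ^ 3 * hy) = 0)).resolve_right (by positivity)
    linear_combination hx * (-x1 + x2 - x3 + x4) / 8 - (v1 - v2 - v3 + v4) / 8
  have h13 : a 1 3 = 0 := by
    refine (mul_eq_zero.1 (?_ : a 1 3 * (hx * hy ^ 3) = 0)).resolve_right (by positivity)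
    linear_combination hy * (-y1 - y2 + y3 + y4) / 8 - (v1 - v2 - v3 + v4) / 8
  refine ⟨4 * a 2 2, fun x y => ?_⟩
  simp [Finset.sum_range_succ, pderiv_X, pderiv_ofNat, h11, h21, h12, h31, h13]
  ring

theorem setIntegral_Icc_sub_center (c h : ℝ) (hh : 0 ≤ h) :
    ∫ x in Set.Icc (c - h) (c + h), (x - c) = 0 := by
  rw [integral_Icc_eq_integral_Ioc, ← intervalIntegral.integral_of_le (by linarith)]
  simp [intervalIntegral.integral_comp_sub_right (fun x : ℝ => x)]

/-- For `u ∈ P₄`, `p ∈ Q_Ad` an Adini interpolant of `u` on the rectangle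
`K = [x_c-h_x, x_c+h_x] × [y_c-h_y, y_c+h_y]`, and any `v ∈ Q_Ad`, the mixed
second derivatives are `L²(K)`-orthogonal: `∫_K (u-p)_xy v_xy = 0`. -/
theorem adini_expansion_identity_xy (xc yc hx hy : ℝ) (hhx : 0 < hx) (hhy : 0 < hy)
    (u p v : MvPolynomial (Fin 2) ℝ) (hu : u.totalDegree ≤ 4) (hp : p ∈ QAd)
    (hv : v ∈ QAd)
    (hval : ∀ s ∈ ({-1, 1} : Set ℝ), ∀ t ∈ ({-1, 1} : Set ℝ),
      eval ![xc + s * hx, yc + t * hy] p = eval ![xc + s * hx, yc + t * hy] u)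
    (hgrad : ∀ s ∈ ({-1, 1} : Set ℝ), ∀ t ∈ ({-1, 1} : Set ℝ),
      eval ![xc + s * hx, yc + t * hy] (pderiv 0 p) =
        eval ![xc + s * hx, yc + t * hy] (pderiv 0 u) ∧
      eval ![xc + s * hx, yc + t * hy] (pderiv 1 p) =
        eval ![xc + s * hx, yc + t * hy] (pderiv 1 u)) :
    (∫ z in (Set.Icc (xc - hx) (xc + hx) ×ˢ Set.Icc (yc - hy) (yc + hy) : Set (ℝ × ℝ)),
        eval ![z.1, z.2] (pderiv 0 (pderiv 1 (u - p))) *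
          eval ![z.1, z.2] (pderiv 0 (pderiv 1 v))) = 0 := by
  have hw : (u - p).totalDegree ≤ 4 :=
    (totalDegree_sub _ _).trans (max_le hu (totalDegree_le_four_of_mem_QAd hp))
  obtain ⟨k, hk⟩ := exists_eval_pderiv_pderiv_of_vanish_vertices (xc := xc) (yc := yc) hhx hhy hw
    (fun s hs t ht => by simp [hval s hs t ht])
    (fun s hs t ht => by simp [(hgrad s hs t ht).1, (hgrad s hs t ht).2])
  obtain ⟨a, b, c, d, e, habcde⟩ := exists_eval_pderiv_pderiv_of_mem_QAd hv xc yc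
  have hsplit (z : ℝ × ℝ) : eval ![z.1, z.2] (pderiv 0 (pderiv 1 (u - p))) *
        eval ![z.1, z.2] (pderiv 0 (pderiv 1 v)) =
      (k * (z.1 - xc) * (a + b * (z.1 - xc) + d * (z.1 - xc) ^ 2)) * (z.2 - yc) +
        (z.1 - xc) * (k * (z.2 - yc) * (c * (z.2 - yc) + e * (z.2 - yc) ^ 2)) := by
    rw [hk, habcde]; ring
  have hK : IsCompact (Set.Icc (xc - hx) (xc + hx) ×ˢ Set.Icc (yc - hy) (yc + hy)) :=
    isCompact_Icc.prod isCompact_Icc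
  simp only [hsplit]
  rw [integral_add (Continuous.continuousOn (by fun_prop) |>.integrableOn_compact hK)
    (Continuous.continuousOn (by fun_prop) |>.integrableOn_compact hK), Measure.volume_eq_prod,
    setIntegral_prod_mul (fun x => k * (x - xc) * (a + b * (x - xc) + d * (x - xc) ^ 2))
      (fun y => y - yc),
    setIntegral_prod_mul (fun x => x - xc)
      (fun y => k * (y - yc) * (c * (y - yc) + e * (y - yc) ^ 2)),
    setIntegral_Icc_sub_center _ _ hhx.le, setIntegral_Icc_sub_center _ _ hhy.le]
  simp
end

section
/- (Structure of functions with constant mixed derivative.) Let $\Omega = (a,b) \times (c,d)$ with $a < b$ and $c < d$, and let $w$ be three times continuously differentiable on $\Omega$ with $\frac{\partial^3 w}{\partial x^2 \partial y} = \frac{\partial^3 w}{\partial x \partial y^2} = 0$ everywhere on $\Omega$. Then there exist a constant $c_0 \in \mathbb{R}$ and functions $h : (a,b) \to \mathbb{R}$ and $g : (c,d) \to \mathbb{R}$ such that $w(x,y) = c_0\, x y + h(x) + g(y)$ for all $(x,y) \in \Omega$. -/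
/-- Partial derivative in the first variable of a function `ℝ → ℝ → ℝ`. -/
noncomputable def pdx (f : ℝ → ℝ → ℝ) : ℝ → ℝ → ℝ :=
  fun x y => deriv (fun t => f t y) x

/-- Partial derivative in the second variable of a function `ℝ → ℝ → ℝ`. -/
noncomputable def pdy (f : ℝ → ℝ → ℝ) : ℝ → ℝ → ℝ :=
  fun x y => deriv (fun t => f x t) y

theorem ContDiffOn.differentiableAt_slice_left {f : ℝ → ℝ → ℝ} {S : Set (ℝ × ℝ)}
    (hS : IsOpen S) {n : WithTop ℕ∞} (hn : n ≠ 0)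
    (hf : ContDiffOn ℝ n (fun z : ℝ × ℝ => f z.1 z.2) S) {x y : ℝ} (h : (x, y) ∈ S) :
    DifferentiableAt ℝ (fun t => f t y) x := by
  have hd : DifferentiableAt ℝ (fun z : ℝ × ℝ => f z.1 z.2) (x, y) :=
    (hf.contDiffAt (hS.mem_nhds h)).differentiableAt hn
  exact DifferentiableAt.comp (f := fun t : ℝ => (t, y)) x hd (by fun_prop)

theorem ContDiffOn.differentiableAt_slice_right {f : ℝ → ℝ → ℝ} {S : Set (ℝ × ℝ)}
    (hS : IsOpen S) {n : WithTop ℕ∞} (hn : n ≠ 0)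
    (hf : ContDiffOn ℝ n (fun z : ℝ × ℝ => f z.1 z.2) S) {x y : ℝ} (h : (x, y) ∈ S) :
    DifferentiableAt ℝ (fun t => f x t) y := by
  have hd : DifferentiableAt ℝ (fun z : ℝ × ℝ => f z.1 z.2) (x, y) :=
    (hf.contDiffAt (hS.mem_nhds h)).differentiableAt hn
  exact DifferentiableAt.comp (f := fun t : ℝ => (x, t)) y hd (by fun_prop)

theorem ContDiffOn.pdx {f : ℝ → ℝ → ℝ} {S : Set (ℝ × ℝ)} (hS : IsOpen S)
    {m n : WithTop ℕ∞} (hmn : m + 1 ≤ n)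
    (hf : ContDiffOn ℝ n (fun z : ℝ × ℝ => f z.1 z.2) S) :
    ContDiffOn ℝ m (fun z : ℝ × ℝ => pdx f z.1 z.2) S := by
  refine ((hf.fderiv_of_isOpen hS hmn).clm_apply
    (contDiffOn_const (c := ((1, 0) : ℝ × ℝ)))).congr fun z hz => ?_
  have hn : n ≠ 0 := by
    rintro rfl
    simp at hmn
  have hd : DifferentiableAt ℝ (fun z : ℝ × ℝ => f z.1 z.2) (z.1, z.2) :=
    (hf.contDiffAt (hS.mem_nhds hz)).differentiableAt hn
  exact (hd.hasFDerivAt.comp_hasDerivAt z.1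
    ((hasDerivAt_id z.1).prodMk (hasDerivAt_const z.1 z.2))).deriv

theorem ContDiffOn.pdy {f : ℝ → ℝ → ℝ} {S : Set (ℝ × ℝ)} (hS : IsOpen S)
    {m n : WithTop ℕ∞} (hmn : m + 1 ≤ n)
    (hf : ContDiffOn ℝ n (fun z : ℝ × ℝ => f z.1 z.2) S) :
    ContDiffOn ℝ m (fun z : ℝ × ℝ => pdy f z.1 z.2) S := by
  refine ((hf.fderiv_of_isOpen hS hmn).clm_apply
    (contDiffOn_const (c := ((0, 1) : ℝ × ℝ)))).congr fun z hz => ?_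
  have hn : n ≠ 0 := by
    rintro rfl
    simp at hmn
  have hd : DifferentiableAt ℝ (fun z : ℝ × ℝ => f z.1 z.2) (z.1, z.2) :=
    (hf.contDiffAt (hS.mem_nhds hz)).differentiableAt hn
  exact (hd.hasFDerivAt.comp_hasDerivAt z.2
    ((hasDerivAt_const z.2 z.1).prodMk (hasDerivAt_id z.2))).deriv

theorem eq_of_hasDerivAt_zero_on_Ioo {f : ℝ → ℝ} {a b : ℝ}
    (hf : ∀ x ∈ Set.Ioo a b, HasDerivAt f 0 x) {x y : ℝ}
    (hx : x ∈ Set.Ioo a b) (hy : y ∈ Set.Ioo a b) : f x = f y :=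
  isOpen_Ioo.is_const_of_deriv_eq_zero isPreconnected_Ioo
    (fun t ht => (hf t ht).differentiableAt.differentiableWithinAt)
    (fun t ht => (hf t ht).deriv) hx hy

/-- Structure of functions with constant mixed derivative: if `w` is `C³` on
the open rectangle `Ω = (a,b) × (c,d)` and `w_xxy = w_xyy = 0` on `Ω`, then
`w(x,y) = c₀ x y + h(x) + g(y)` on `Ω` for some constant `c₀` and functions
`h`, `g` of one variable. -/
theorem constant_mixed_derivative_structure (a b c d : ℝ) (hab : a < b) (hcd : c < d)
    (w : ℝ → ℝ → ℝ)
    (hw : ContDiffOn ℝ 3 (fun z : ℝ × ℝ => w z.1 z.2)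
      (Set.Ioo a b ×ˢ Set.Ioo c d))
    (hthird : ∀ z ∈ (Set.Ioo a b ×ˢ Set.Ioo c d : Set (ℝ × ℝ)),
      pdx (pdx (pdy w)) z.1 z.2 = 0 ∧ pdx (pdy (pdy w)) z.1 z.2 = 0) :
    ∃ (c₀ : ℝ) (h : ℝ → ℝ) (g : ℝ → ℝ),
      ∀ x ∈ Set.Ioo a b, ∀ y ∈ Set.Ioo c d,
        w x y = c₀ * x * y + h x + g y := by
  have hS : IsOpen (Set.Ioo a b ×ˢ Set.Ioo c d) := isOpen_Ioo.prod isOpen_Ioo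
  have hu : ContDiffOn ℝ 2 (fun z : ℝ × ℝ => pdy w z.1 z.2) (Set.Ioo a b ×ˢ Set.Ioo c d) :=
    hw.pdy hS (by norm_num)
  have hux : ContDiffOn ℝ 1 (fun z : ℝ × ℝ => pdx (pdy w) z.1 z.2)
      (Set.Ioo a b ×ˢ Set.Ioo c d) := hu.pdx hS (by norm_num)
  have huy : ContDiffOn ℝ 1 (fun z : ℝ × ℝ => pdy (pdy w) z.1 z.2)
      (Set.Ioo a b ×ˢ Set.Ioo c d) := hu.pdy hS (by norm_num)
  obtain ⟨x₀, hx₀⟩ := Set.nonempty_Ioo.2 hab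
  obtain ⟨y₀, hy₀⟩ := Set.nonempty_Ioo.2 hcd
  obtain ⟨x₁, hx₁⟩ := Set.nonempty_Ioo.2 hx₀.2
  have hx₁' : x₁ ∈ Set.Ioo a b := ⟨hx₀.1.trans hx₁.1, hx₁.2⟩
  have hpx : ∀ x ∈ Set.Ioo a b, ∀ y ∈ Set.Ioo c d,
      pdx (pdy w) x y = pdx (pdy w) x₀ y := fun x hx y hy =>
    eq_of_hasDerivAt_zero_on_Ioo (f := fun t => pdx (pdy w) t y) (fun t ht => by
      have h := (hux.differentiableAt_slice_left hS one_ne_zero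
        (Set.mk_mem_prod ht hy)).hasDerivAt
      rwa [show deriv (fun t => pdx (pdy w) t y) t = 0 from
        (hthird (t, y) (Set.mk_mem_prod ht hy)).1] at h) hx hx₀
  have hpy : ∀ x ∈ Set.Ioo a b, ∀ y ∈ Set.Ioo c d,
      pdy (pdy w) x y = pdy (pdy w) x₀ y := fun x hx y hy =>
    eq_of_hasDerivAt_zero_on_Ioo (f := fun t => pdy (pdy w) t y) (fun t ht => by
      have h := (huy.differentiableAt_slice_left hS one_ne_zero
        (Set.mk_mem_prod ht hy)).hasDerivAt
      rwa [show deriv (fun t => pdy (pdy w) t y) t = 0 from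
        (hthird (t, y) (Set.mk_mem_prod ht hy)).2] at h) hx hx₀
  have haff : ∀ x ∈ Set.Ioo a b, ∀ y ∈ Set.Ioo c d,
      pdy w x y - pdx (pdy w) x₀ y * x = pdy w x₀ y - pdx (pdy w) x₀ y * x₀ :=
    fun x hx y hy => eq_of_hasDerivAt_zero_on_Ioo
      (f := fun t => pdy w t y - pdx (pdy w) x₀ y * t) (fun t ht => by
        have h : HasDerivAt (fun t => pdy w t y) (pdx (pdy w) t y) t :=
          (hu.differentiableAt_slice_left hS two_ne_zero (Set.mk_mem_prod ht hy)).hasDerivAt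
        rw [hpx t ht y hy] at h
        exact (h.sub ((hasDerivAt_id' t).const_mul (pdx (pdy w) x₀ y))).congr_deriv
          (by ring)) hx hx₀
  have hdiff : ∀ y ∈ Set.Ioo c d,
      pdy w x₁ y - pdy w x₀ y = pdy w x₁ y₀ - pdy w x₀ y₀ := fun y hy =>
    eq_of_hasDerivAt_zero_on_Ioo (f := fun t => pdy w x₁ t - pdy w x₀ t) (fun t ht => by
      have h₁ : HasDerivAt (fun t => pdy w x₁ t) (pdy (pdy w) x₁ t) t :=
        (hu.differentiableAt_slice_right hS two_ne_zero (Set.mk_mem_prod hx₁' ht)).hasDerivAt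
      have h₀ : HasDerivAt (fun t => pdy w x₀ t) (pdy (pdy w) x₀ t) t :=
        (hu.differentiableAt_slice_right hS two_ne_zero (Set.mk_mem_prod hx₀ ht)).hasDerivAt
      rw [hpy x₁ hx₁' t ht] at h₁
      exact (h₁.sub h₀).congr_deriv (sub_self _)) hy hy₀
  have hconst : ∀ y ∈ Set.Ioo c d, pdx (pdy w) x₀ y = pdx (pdy w) x₀ y₀ := fun y hy => by
    refine mul_right_cancel₀ (sub_ne_zero.2 hx₁.1.ne') ?_
    linear_combination hdiff y hy - haff x₁ hx₁' y hy + haff x₁ hx₁' y₀ hy₀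
  set c₀ := pdx (pdy w) x₀ y₀
  refine ⟨c₀, fun x => w x y₀ - w x₀ y₀ - c₀ * (x - x₀) * y₀,
    fun y => w x₀ y - c₀ * x₀ * y, fun x hx y hy => ?_⟩
  have hfin : w x y - w x₀ y - c₀ * (x - x₀) * y =
      w x y₀ - w x₀ y₀ - c₀ * (x - x₀) * y₀ :=
    eq_of_hasDerivAt_zero_on_Ioo
      (f := fun t => w x t - w x₀ t - c₀ * (x - x₀) * t) (fun t ht => by
        have h₁ : HasDerivAt (fun t => w x t) (pdy w x t) t :=
          (hw.differentiableAt_slice_right hS three_ne_zero (Set.mk_mem_prod hx ht)).hasDerivAt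
        have h₀ : HasDerivAt (fun t => w x₀ t) (pdy w x₀ t) t :=
          (hw.differentiableAt_slice_right hS three_ne_zero (Set.mk_mem_prod hx₀ ht)).hasDerivAt
        have hz : pdy w x t - pdy w x₀ t - c₀ * (x - x₀) * 1 = 0 := by
          have h := haff x hx t ht
          rw [hconst t ht] at h
          linear_combination h
        exact ((h₁.sub h₀).sub
          ((hasDerivAt_id' t).const_mul (c₀ * (x - x₀)))).congr_deriv hz) hy hy₀
  linear_combination hfin
end
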